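/- arXiv:math/0608747 — 2 statements merged into one kernel-verified Lean document; each statement's English description precedes it below -/
import Mathlib

section
/- Let (T,(X_1,…,X_s)) be a tableau with substitution of dimension (n_1,…,n_m) with distinguished columns q_1, q_2 and n_{q_1} = n_{q_2} = n, and let π_1, π_2 ∈ S_n. Then π_1 = π_2 if and only if T_o^{π_1} ∼t T_o^{π_2} and T_cl^{π_1} ∼ct T_cl^{π_2}; that is, a permutation τ ∈ S_n is uniquely determined by T, the set of open paths of T^τ up to transpose-equivalence of the underlying words of arrows of T, and the set of closed paths of T^τ up to cyclic-permutation-and-transpose-equivalence of the underlying words of arrows of T. -/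
open scoped BigOperators
set_option linter.unusedVariables false

attribute [local instance] Classical.propDecidable

/-- The cells of a shape of dimension `n : ι → ℕ`: the column `i` has `n i` cells. -/
abbrev TabCell {ι : Type} (n : ι → ℕ) : Type := Σ i : ι, Fin (n i)

/-- A tableau with substitution `(T,(X_1,…,X_s))` of dimension `n : ι → ℕ` with entries
in `A`.  Cells are paired by the involution `mate` (each pair of cells is an arrow going
from the tail cell, where `isTail` holds, to the head cell); `lab` assigns to every
arrow (encoded via either of its two cells) its index `φ ∈ {1,…,s}`; `X j` is the matrix
assigned to the arrows with label `j`, which is an `n_{a''} × n_{a'}` matrix where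
`colTail j = a''` and `colHead j = a'` are the tail and head columns of those arrows. -/
structure TabSub (A : Type) [CommRing A] (ι : Type) [Fintype ι] [DecidableEq ι]
    (n : ι → ℕ) (s : ℕ) where
  mate : Equiv.Perm (TabCell n)
  isTail : TabCell n → Bool
  lab : TabCell n → Fin s
  colTail : Fin s → ι
  colHead : Fin s → ι
  X : ∀ j : Fin s, Matrix (Fin (n (colTail j))) (Fin (n (colHead j))) A
  mate_ne : ∀ c, mate c ≠ c
  mate_invol : ∀ c, mate (mate c) = c
  isTail_mate : ∀ c, isTail (mate c) = !isTail c
  lab_mate : ∀ c, lab (mate c) = lab c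
  lab_surj : ∀ j : Fin s, ∃ c, isTail c = true ∧ lab c = j
  colTail_eq : ∀ c, isTail c = true → colTail (lab c) = c.1
  colHead_eq : ∀ c, isTail c = true → colHead (lab c) = (mate c).1

namespace TabSub

variable {A : Type} [CommRing A] {ι : Type} [Fintype ι] [DecidableEq ι] {n : ι → ℕ} {s : ℕ}

/-- The entry of a (rectangular) matrix at a pair of natural number indices, extended
by zero outside the range. -/
def castEntry {a b : ι} (M : Matrix (Fin (n a)) (Fin (n b)) A) (i j : ℕ) : A :=
  if h : i < n a ∧ j < n b then M ⟨i, h.1⟩ ⟨j, h.2⟩ else 0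

/-- The set of tail cells of a tableau; tail cells are in bijection with arrows. -/
noncomputable def tails (T : TabSub A ι n s) : Finset (TabCell n) :=
  Finset.univ.filter fun c => T.isTail c = true

/-- `sgn(π_1)⋯sgn(π_m)` for a tuple of permutations of the columns. -/
def sgnT (π : ∀ i : ι, Equiv.Perm (Fin (n i))) : ℤ :=
  ∏ i, (Equiv.Perm.sign (π i) : ℤ)

/-- The factor `(X_{φ(a)})_{π_{a''}(''a), π_{a'}('a)}` contributed by the arrow with
tail cell `c`. -/
def entry (T : TabSub A ι n s) (π : ∀ i : ι, Equiv.Perm (Fin (n i))) (c : TabCell n) : A :=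
  castEntry (T.X (T.lab c)) (π c.1 c.2 : Fin (n c.1)).1
    ((π (T.mate c).1 (T.mate c).2 : Fin (n (T.mate c).1)).1)

/-- `bpf⁰_T(X_1,…,X_s)`: the sum over all tuples of permutations. -/
noncomputable def bpf0 (T : TabSub A ι n s) : A :=
  ∑ π : ∀ i : ι, Equiv.Perm (Fin (n i)), sgnT π • ∏ c ∈ T.tails, T.entry π c

/-- The condition on a tuple of permutations appearing in `bpf`: whenever
`φ(a) = φ(b)` and `''a < ''b` then `π_i(''a) < π_i(''b)`. -/
def SortedPi (T : TabSub A ι n s) (π : ∀ i : ι, Equiv.Perm (Fin (n i))) : Prop :=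
  ∀ c ∈ T.tails, ∀ d ∈ T.tails, T.lab c = T.lab d → (c.2 : ℕ) < (d.2 : ℕ) →
    ((π c.1 c.2 : Fin (n c.1)) : ℕ) < ((π d.1 d.2 : Fin (n d.1)) : ℕ)

/-- `bpf_T(X_1,…,X_s)`. -/
noncomputable def bpf (T : TabSub A ι n s) : A :=
  ∑ π ∈ Finset.univ.filter T.SortedPi, sgnT π • ∏ c ∈ T.tails, T.entry π c

/-- Conjugating a tableau with substitution by a column-preserving permutation of the
cells. -/
def permTab (T : TabSub A ι n s) (ρ : Equiv.Perm (TabCell n))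
    (hρ : ∀ c, (ρ c).1 = c.1) : TabSub A ι n s where
  mate := (ρ.symm.trans T.mate).trans ρ
  isTail c := T.isTail (ρ.symm c)
  lab c := T.lab (ρ.symm c)
  colTail := T.colTail
  colHead := T.colHead
  X := T.X
  mate_ne c h := by
    refine T.mate_ne (ρ.symm c) ?_
    simpa using congrArg ρ.symm h
  mate_invol c := by simp [T.mate_invol]
  isTail_mate c := by simpa using T.isTail_mate (ρ.symm c)
  lab_mate c := by simpa using T.lab_mate (ρ.symm c)
  lab_surj j := by
    obtain ⟨c, hc1, hc2⟩ := T.lab_surj j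
    exact ⟨ρ c, by simpa using hc1, by simpa using hc2⟩
  colTail_eq c h := by
    have h1 := T.colTail_eq (ρ.symm c) h
    have h2 : (ρ (ρ.symm c)).1 = (ρ.symm c).1 := hρ (ρ.symm c)
    simpa [h1] using h2.symm
  colHead_eq c h := by
    have h1 := T.colHead_eq (ρ.symm c) h
    have h2 := hρ (T.mate (ρ.symm c))
    simp only [Equiv.trans_apply]
    rw [h1, h2]

/-- The permutation of the cells permuting the cells of column `q` by `τ`. -/
def colPerm (n : ι → ℕ) (q : ι) (τ : Equiv.Perm (Fin (n q))) : Equiv.Perm (TabCell n) :=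
  Equiv.sigmaCongrRight fun i =>
    if h : i = q then ((finCongr (congrArg n h)).permCongr.symm τ) else Equiv.refl _

/-- The tableau `T^τ` obtained from `T` by permuting the cells of column `q` by `τ`. -/
def tw (T : TabSub A ι n s) (q : ι) (τ : Equiv.Perm (Fin (n q))) : TabSub A ι n s :=
  T.permTab (colPerm n q τ) (fun _ => rfl)

end TabSub

namespace TabSub

variable {A : Type} [CommRing A] {ι : Type} [Fintype ι] [DecidableEq ι] {n : ι → ℕ} {s : ℕ}

/-! ### Oriented arrows, paths, and the matrices they carry

An element `a ∈t T` (an arrow of `T` or the transpose of one) is encoded by a cell `c`: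
the oriented arrow with tail cell `c` and head cell `T.mate c`.  If `c` is a tail cell
this is the arrow itself, otherwise it is the transpose of an arrow. -/

/-- The letter `φ(a) ∈ M_T` of an oriented arrow: its label together with a flag telling
whether it is transposed. -/
def letter (T : TabSub A ι n s) (c : TabCell n) : Fin s × Bool := (T.lab c, !T.isTail c)

/-- The word `φ(a_1)⋯φ(a_r) ∈ M_T` of a word of oriented arrows. -/
def word (T : TabSub A ι n s) (l : List (TabCell n)) : List (Fin s × Bool) :=
  l.map T.letter

/-- The entries (as a function on natural number indices, extended by zero) of the
matrix `X_{φ(a)}` assigned to an oriented arrow: rows are indexed by its tail column,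
columns by its head column; for a transposed arrow this is the transposed matrix. -/
def matOf (T : TabSub A ι n s) (c : TabCell n) : ℕ → ℕ → A :=
  fun i j => if T.isTail c then castEntry (T.X (T.lab c)) i j else castEntry (T.X (T.lab c)) j i

/-- The product of a list of `ℕ×ℕ`-indexed matrices, all summations being over
`Finset.range B`. -/
def matListProd (B : ℕ) : List (ℕ → ℕ → A) → ℕ → ℕ → A
  | [] => fun i j => if i = j then 1 else 0
  | f :: fs => fun i j => ∑ p ∈ Finset.range B, f i p * matListProd B fs p j

/-- A bound exceeding the sizes of all matrices involved. -/
def dimBound (n : ι → ℕ) [Fintype ι] : ℕ := ∑ i, n i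

/-- The entries of the product matrix `X_{φ(a_1)}⋯X_{φ(a_r)}` of a word of oriented
arrows (the product being `0` if the sizes do not match). -/
def pathMat (T : TabSub A ι n s) (l : List (TabCell n)) : ℕ → ℕ → A :=
  matListProd (dimBound n) (l.map T.matOf)

/-- The trace of the matrix of a (closed) word of oriented arrows. -/
def pathTr (T : TabSub A ι n s) (l : List (TabCell n)) : A :=
  ∑ p ∈ Finset.range (dimBound n), T.pathMat l p p

/-- The entries of the matrix `X_u` of a word `u ∈ M_T` in the letters
`1,…,s,1ᵗ,…,sᵗ` (the product being `0` if the sizes do not match). -/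
def wordMat (T : TabSub A ι n s) (w : List (Fin s × Bool)) : ℕ → ℕ → A :=
  matListProd (dimBound n)
    (w.map fun p => fun i j =>
      if p.2 then castEntry (T.X p.1) j i else castEntry (T.X p.1) i j)

/-- `σ_k(X)`: the coefficient in the characteristic polynomial defined by
`det(λE − X) = λ^n − σ_1(X)λ^{n−1} + ⋯ + (−1)^n σ_n(X)`. -/
noncomputable def sigmaCoeff (N : ℕ) (M : Matrix (Fin N) (Fin N) A) (k : ℕ) : A :=
  (-1) ^ k * (Matrix.charpoly M).coeff (N - k)

/-- `σ_k(X_u)` for a word `u ∈ M_T`. -/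
noncomputable def wordSigma (T : TabSub A ι n s) (w : List (Fin s × Bool)) (k : ℕ) : A :=
  sigmaCoeff (dimBound n) (Matrix.of fun i j : Fin (dimBound n) => T.wordMat w i j) k

/-- Oriented arrows `a_1, a_2` are successive (with respect to the distinguished columns
`q_1, q_2`): `a_1', a_2'' ∈ {q_1,q_2}`, `a_1' ≠ a_2''` and `'a_1 = ''a_2`. -/
def Succ (T : TabSub A ι n s) (q1 q2 : ι) (c d : TabCell n) : Prop :=
  ((T.mate c).1 = q1 ∨ (T.mate c).1 = q2) ∧ (d.1 = q1 ∨ d.1 = q2) ∧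
    (T.mate c).1 ≠ d.1 ∧ ((T.mate c).2 : ℕ) = (d.2 : ℕ)

/-- A path in `T` with respect to the columns `q_1` and `q_2`: a (nonempty, repetition
free) word of oriented arrows in which consecutive arrows are successive. -/
def IsPath (T : TabSub A ι n s) (q1 q2 : ι) (l : List (TabCell n)) : Prop :=
  l ≠ [] ∧ l.Chain' (T.Succ q1 q2) ∧ l.Nodup

/-- An open path: a path passing through the columns `q_1,q_2` whose first tail and
last head lie outside `{q_1,q_2}`. -/
def IsOpenPath (T : TabSub A ι n s) (q1 q2 : ι) (l : List (TabCell n)) : Prop :=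
  T.IsPath q1 q2 l ∧ 2 ≤ l.length ∧ ∀ h : l ≠ [],
    ((l.head h).1 ≠ q1 ∧ (l.head h).1 ≠ q2) ∧
    ((T.mate (l.getLast h)).1 ≠ q1 ∧ (T.mate (l.getLast h)).1 ≠ q2)

/-- A closed path: a path whose last and first arrows are also successive. -/
def IsClosedPath (T : TabSub A ι n s) (q1 q2 : ι) (l : List (TabCell n)) : Prop :=
  T.IsPath q1 q2 l ∧ ∀ h : l ≠ [], T.Succ q1 q2 (l.getLast h) (l.head h)

/-- The transpose `aᵗ = a_rᵗ⋯a_1ᵗ` of a word of oriented arrows. -/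
def tp (T : TabSub A ι n s) (l : List (TabCell n)) : List (TabCell n) :=
  (l.map T.mate).reverse

/-- Equality of words of oriented arrows up to transposition (`=t`). -/
def eqT (T : TabSub A ι n s) (l l' : List (TabCell n)) : Prop :=
  l = l' ∨ l = T.tp l'

/-- Equality of words of oriented arrows up to cyclic permutation and transposition
(`=ct`). -/
def eqCT (T : TabSub A ι n s) (l l' : List (TabCell n)) : Prop :=
  l.IsRotated l' ∨ l.IsRotated (T.tp l')

/-- `R` is a set of representatives of the open paths of `T` (w.r.t. `q_1,q_2`) modulo
the `=t`-equivalence. -/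
def OpenReps (T : TabSub A ι n s) (q1 q2 : ι) (R : Finset (List (TabCell n))) : Prop :=
  (∀ l ∈ R, T.IsOpenPath q1 q2 l) ∧
  ∀ l, T.IsOpenPath q1 q2 l → ∃! l', l' ∈ R ∧ T.eqT l l'

/-- `R` is a set of representatives of the closed paths of `T` (w.r.t. `q_1,q_2`)
modulo the `=ct`-equivalence. -/
def ClosedReps (T : TabSub A ι n s) (q1 q2 : ι) (R : Finset (List (TabCell n))) : Prop :=
  (∀ l ∈ R, T.IsClosedPath q1 q2 l) ∧
  ∀ l, T.IsClosedPath q1 q2 l → ∃! l', l' ∈ R ∧ T.eqCT l l'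

/-- `tr(T_cl) = ∏_{a ∈ T_cl} tr(X_{φ(a)})` for a set `R` of representatives of the
closed paths. -/
noncomputable def trClosed (T : TabSub A ι n s) (R : Finset (List (TabCell n))) : A :=
  ∏ l ∈ R, T.pathTr l

end TabSub

/-! ### Words in the free monoid `M_T` -/

/-- The transpose `uᵗ` of a word `u ∈ M_T` in the letters `1,…,s,1ᵗ,…,sᵗ`. -/
def wtp {s : ℕ} (w : List (Fin s × Bool)) : List (Fin s × Bool) :=
  (w.map fun p => (p.1, !p.2)).reverse

/-- Equality of words in `M_T` up to transposition (`=t`). -/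
def weqT {s : ℕ} (w w' : List (Fin s × Bool)) : Prop := w = w' ∨ w = wtp w'

/-- Equality of words in `M_T` up to cyclic permutation and transposition (`=ct`). -/
def weqCT {s : ℕ} (w w' : List (Fin s × Bool)) : Prop :=
  w.IsRotated w' ∨ w.IsRotated (wtp w')

/-- A word in a free monoid is primitive if it is not a power (with at least two
factors) of a word. -/
def PrimitiveWord {α : Type*} (w : List α) : Prop :=
  w ≠ [] ∧ ∀ (u : List α) (r : ℕ), 2 ≤ r → w ≠ (List.replicate r u).flatten

namespace TabSub

variable {A : Type} [CommRing A] {ι : Type} [Fintype ι] [DecidableEq ι] {n : ι → ℕ} {s : ℕ}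

/-! ### The tableau `T̃` -/

/-- The inclusion of the cells of the shape with the columns `q_1, q_2` deleted into the
cells of the original shape. -/
def embCell (q1 q2 : ι) (c : TabCell (fun i : {i : ι // i ≠ q1 ∧ i ≠ q2} => n i.1)) :
    TabCell n := ⟨c.1.1, c.2⟩

/-- The word in `M_T` corresponding to an arrow of `T̃` with tail cell `c'`: for an old
arrow (Case A) it is the single letter `φ(a)`; for an arrow coming from an open path
`l ∈ Ro` starting at `c'` (Case B) it is `φ(l)`. -/
noncomputable def tildeWord (T : TabSub A ι n s) (q1 q2 : ι)
    (Ro : Finset (List (TabCell n)))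
    (c' : TabCell (fun i : {i : ι // i ≠ q1 ∧ i ≠ q2} => n i.1)) : List (Fin s × Bool) :=
  if ((T.mate (embCell q1 q2 c')).1 ≠ q1 ∧ (T.mate (embCell q1 q2 c')).1 ≠ q2) then
    [T.letter (embCell q1 q2 c')]
  else
    T.word ((Ro.filter fun l => l.head? = some (embCell q1 q2 c')).toList.headI)

end TabSub

namespace TabSub

variable {A : Type} [CommRing A] {ι : Type} [Fintype ι] [DecidableEq ι] {n : ι → ℕ} {s : ℕ}

/-- `D` is (a tableau with substitution equal to) the tableau `T̃` associated with `T`,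
the columns `q_1, q_2`, and the set `Ro` of representatives of open paths.  Its arrows
are the arrows of `T` lying entirely outside the columns `q_1, q_2` (Case A, carrying
the same matrices), together with one arrow for each open path `l ∈ Ro`, going from the
tail of the first arrow of `l` to the head of its last arrow and carrying the matrix
`X_{φ(l)}` (Case B); two arrows of `D` carry the same label iff the corresponding words
in `M_T` coincide. -/
def IsTilde (T : TabSub A ι n s) (q1 q2 : ι) (Ro : Finset (List (TabCell n))) {t : ℕ}
    (D : TabSub A {i : ι // i ≠ q1 ∧ i ≠ q2} (fun i => n i.1) t) : Prop :=
  (∀ c' : TabCell (fun i : {i : ι // i ≠ q1 ∧ i ≠ q2} => n i.1),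
    ((T.mate (embCell q1 q2 c')).1 ≠ q1 ∧ (T.mate (embCell q1 q2 c')).1 ≠ q2) →
      D.isTail c' = T.isTail (embCell q1 q2 c') ∧
      embCell q1 q2 (D.mate c') = T.mate (embCell q1 q2 c') ∧
      ∀ i j, D.matOf c' i j = T.matOf (embCell q1 q2 c') i j) ∧
  (∀ l ∈ Ro, ∀ (h : l ≠ []) (h1 : (l.head h).1 ≠ q1 ∧ (l.head h).1 ≠ q2),
      D.isTail ⟨⟨(l.head h).1, h1⟩, (l.head h).2⟩ = true ∧
      embCell q1 q2 (D.mate ⟨⟨(l.head h).1, h1⟩, (l.head h).2⟩) = T.mate (l.getLast h) ∧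
      ∀ i j, D.matOf ⟨⟨(l.head h).1, h1⟩, (l.head h).2⟩ i j = T.pathMat l i j) ∧
  (∀ c' d', D.isTail c' = true → D.isTail d' = true →
      (D.lab c' = D.lab d' ↔ tildeWord T q1 q2 Ro c' = tildeWord T q1 q2 Ro d'))

end TabSub

/-! ### Quadruples and the sets `S_τ`, `S_{β,γ,b,c}` -/

/-- The data of a quadruple `(β,γ,b,c)` with `β ∈ ℕ^p`, `γ ∈ ℕ^q` and `b`, `c`
sequences of words in `M_T`. -/
structure QuadData (s : ℕ) where
  p : ℕ
  q : ℕ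
  β : Fin p → ℕ
  γ : Fin q → ℕ
  b : Fin p → List (Fin s × Bool)
  c : Fin q → List (Fin s × Bool)

namespace QuadData

variable {s : ℕ}

/-- `(β,γ,b,c)` is a `T`-quadruple: the `b_i`, `c_j` are primitive, the `b_i` are
pairwise different with respect to `=t` and the `c_j` pairwise different with respect
to `=ct`. -/
def IsQuad (Q : QuadData s) : Prop :=
  (∀ i, PrimitiveWord (Q.b i)) ∧ (∀ j, PrimitiveWord (Q.c j)) ∧
  (∀ i i', i ≠ i' → ¬ weqT (Q.b i) (Q.b i')) ∧
  (∀ j j', j ≠ j' → ¬ weqCT (Q.c j) (Q.c j'))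

/-- The multiset `{{b_1,…,b_1,…,b_p,…,b_p}}` with `b_i` of multiplicity `β_i`. -/
def mB (Q : QuadData s) : Multiset (List (Fin s × Bool)) :=
  ∑ i, Multiset.replicate (Q.β i) (Q.b i)

/-- The multiset `{{c_1,…,c_1,…,c_q,…,c_q}}` with `c_j` of multiplicity `γ_j`. -/
def mC (Q : QuadData s) : Multiset (List (Fin s × Bool)) :=
  ∑ j, Multiset.replicate (Q.γ j) (Q.c j)

/-- Equivalence of quadruples: the associated multisets agree up to `=t` (for `b`)
and up to `=ct` (for `c`). -/
def Equiv (Q Q' : QuadData s) : Prop :=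
  Multiset.Rel weqT Q.mB Q'.mB ∧ Multiset.Rel weqCT Q.mC Q'.mC

end QuadData

namespace TabSub

variable {A : Type} [CommRing A] {ι : Type} [Fintype ι] [DecidableEq ι] {n : ι → ℕ} {s : ℕ}

/-- The multiset `φ(T_o)` (or `φ(T_cl)`) of words in `M_T` of a set `R` of
representative paths. -/
def wordsOf (T : TabSub A ι n s) (R : Finset (List (TabCell n))) :
    Multiset (List (Fin s × Bool)) :=
  R.val.map T.word

/-- `ξ` witnesses the `T`-admissibility of the quadruple `Q`, with respect to the given
families `Ro ξ`, `Rcl ξ` of representatives of the open and closed paths of `T^ξ`: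
`φ(T^ξ_o) =t {{b_i with multiplicity β_i}}` and
`φ(T^ξ_cl) =ct {{c_j with multiplicity γ_j}}`. -/
def Witness (T : TabSub A ι n s) (q1 q2 : ι)
    (Ro Rcl : Finset (List (TabCell n))) (Q : QuadData s) : Prop :=
  Multiset.Rel weqT (T.wordsOf Ro) Q.mB ∧ Multiset.Rel weqCT (T.wordsOf Rcl) Q.mC

/-- The quadruple `Q` is `T`-admissible. -/
def Admissible (T : TabSub A ι n s) (q1 q2 : ι) (hn : n q1 = n q2)
    (Ro Rcl : Equiv.Perm (Fin (n q2)) → Finset (List (TabCell n)))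
    (Q : QuadData s) : Prop :=
  Q.IsQuad ∧ ∃ ξ : Equiv.Perm (Fin (n q2)), Witness (T.tw q2 ξ) q1 q2 (Ro ξ) (Rcl ξ) Q

/-- Membership `τ ∈ S_{β,γ,b,c}`: `φ(T^τ_o) =t {{b_i with multiplicity β_i}}` and
`φ(T^τ_cl) =ct {{c_1^{λ_{11}},…,c_1^{λ_{1l_1}},…,c_q^{λ_{q1}},…,c_q^{λ_{ql_q}}}}` for
some positive integers `λ_{ij}` with `λ_{i1}+⋯+λ_{il_i} = γ_i`. -/
def SQuadMem (T : TabSub A ι n s) (q1 q2 : ι)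
    (Ro Rcl : Equiv.Perm (Fin (n q2)) → Finset (List (TabCell n)))
    (Q : QuadData s) (τ : Equiv.Perm (Fin (n q2))) : Prop :=
  Multiset.Rel weqT ((T.tw q2 τ).wordsOf (Ro τ)) Q.mB ∧
  ∃ L : Fin Q.q → Multiset ℕ,
    (∀ j, (∀ x ∈ L j, 0 < x) ∧ (L j).sum = Q.γ j) ∧
    Multiset.Rel weqCT ((T.tw q2 τ).wordsOf (Rcl τ))
      (∑ j, (L j).map fun lam => (List.replicate lam (Q.c j)).flatten)

/-- The set `S_τ` of permutations `π` with `φ(T^π_o) =t φ(T^τ_o)` and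
`φ(T^π_cl) =ct φ(T^τ_cl)`. -/
def SPerm (T : TabSub A ι n s) (q1 q2 : ι)
    (Ro Rcl : Equiv.Perm (Fin (n q2)) → Finset (List (TabCell n)))
    (τ : Equiv.Perm (Fin (n q2))) : Set (Equiv.Perm (Fin (n q2))) :=
  {π | Multiset.Rel weqT ((T.tw q2 π).wordsOf (Ro π)) ((T.tw q2 τ).wordsOf (Ro τ)) ∧
       Multiset.Rel weqCT ((T.tw q2 π).wordsOf (Rcl π)) ((T.tw q2 τ).wordsOf (Rcl τ))}

/-! ### Auxiliary constructions for Lemmas about `T^π` -/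

/-- The word of arrows of `T` underlying a word of arrows of `T^τ`. -/
def underlying (T : TabSub A ι n s) (q2 : ι) (τ : Equiv.Perm (Fin (n q2)))
    (l : List (TabCell n)) : List (TabCell n) :=
  l.map (colPerm n q2 τ).symm

/-- The cell number of a cell lying in column `q_1` or `q_2`, as an element of
`Fin (n q2)` (using `n q1 = n q2`). -/
def toQ2 {q1 q2 : ι} (hn : n q1 = n q2) (c : TabCell n) (h : c.1 = q1 ∨ c.1 = q2) :
    Fin (n q2) :=
  if h2 : c.1 = q2 then Fin.cast (congrArg n h2) c.2
  else Fin.cast ((congrArg n (h.resolve_right h2)).trans hn) c.2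

/-- The substitution `a → b, b → a` on oriented arrows (hence also `aᵗ → bᵗ, bᵗ → aᵗ`). -/
def swapSub (T : TabSub A ι n s) (a b : TabCell n) (c : TabCell n) : TabCell n :=
  if c = a then b else if c = b then a
  else if c = T.mate a then T.mate b else if c = T.mate b then T.mate a else c

end TabSub

namespace Stmt14Aux

section abstractChain
variable {α : Type} [Fintype α] {R : α → α → Prop}

theorem tail_pred {l : List α} (hl : l.IsChain R) {e : α} (he : e ∈ l) (hne : l ≠ [])
    (hh : e ≠ l.head hne) : ∃ a b, l = a ++ b ∧ ∃ ha : a ≠ [], R (a.getLast ha) e ∧ e ∈ b := by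
  obtain ⟨a, b, rfl⟩ := List.append_of_mem he
  have ha : a ≠ [] := by
    rintro rfl
    simp at hh
  refine ⟨a, e :: b, rfl, ha, ?_, by simp⟩
  rw [List.isChain_append] at hl
  exact hl.2.2 _ (List.getLast_mem_getLast? ha) _ (by simp)

theorem dropLast_succ {l : List α} (hl : l.IsChain R) {e : α} (he : e ∈ l) (hne : l ≠ [])
    (hh : e ≠ l.getLast hne) : ∃ a b, l = a ++ b ∧ ∃ hb : b ≠ [], R e (b.head hb) ∧ e ∈ a := by
  obtain ⟨a, b, rfl⟩ := List.append_of_mem he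
  have hb : b ≠ [] := by
    rintro rfl
    simp at hh
  refine ⟨a ++ [e], b, by simp, hb, ?_, by simp⟩
  rw [show a ++ e :: b = (a ++ [e]) ++ b by simp, List.isChain_append] at hl
  exact hl.2.2 _ (by simp) _ (List.head_mem_head? hb)

theorem exists_maximal_chain {c d : α} (hcd : R c d) (hne : c ≠ d) :
    ∃ l : List α, (l.IsChain R ∧ l.Nodup ∧ [c, d] <:+: l) ∧
      ∀ l' : List α, (l'.IsChain R ∧ l'.Nodup ∧ [c, d] <:+: l') → l'.length ≤ l.length := by
  by_contra hcon
  push Not at hcon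
  have key : ∀ k : ℕ, ∃ l : List α, (l.IsChain R ∧ l.Nodup ∧ [c, d] <:+: l) ∧ k ≤ l.length := by
    intro k
    induction k with
    | zero => exact ⟨[c, d], ⟨by simpa using hcd, by simpa using hne, List.infix_rfl⟩, by simp⟩
    | succ k ih =>
      obtain ⟨l, hl, hk⟩ := ih
      obtain ⟨l', hl', hk'⟩ := hcon l hl
      exact ⟨l', hl', by omega⟩
  obtain ⟨l, hl, hk⟩ := key (Fintype.card α + 1)
  have := hl.2.1.length_le_card
  omega

theorem chain_dichotomy (hf : ∀ a b b', R a b → R a b' → b = b')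
    (hi : ∀ a a' b, R a b → R a' b → a = a') {c d : α} (hcd : R c d) :
    (∃ l : List α, l.IsChain R ∧ l.Nodup ∧ [c, d] <:+: l ∧ ∀ h : l ≠ [],
        (∀ p, ¬ R p (l.head h)) ∧ (∀ p, ¬ R (l.getLast h) p)) ∨
    (∃ l : List α, l ≠ [] ∧ l.IsChain R ∧ l.Nodup ∧ c ∈ l ∧
        ∀ h : l ≠ [], R (l.getLast h) (l.head h)) := by
  by_cases hne : c = d
  · subst hne
    exact Or.inr ⟨[c], by simp, by simp, by simp, by simp, fun _ => by simpa using hcd⟩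
  obtain ⟨l, ⟨hc, hn, hin⟩, hmax⟩ := exists_maximal_chain hcd hne
  have hcl : c ∈ l := hin.subset (by simp)
  have h : l ≠ [] := List.ne_nil_of_mem hcl
  by_cases hcl' : R (l.getLast h) (l.head h)
  · exact Or.inr ⟨l, h, hc, hn, hcl, fun _ => hcl'⟩
  refine Or.inl ⟨l, hc, hn, hin, fun _ => ⟨?_, ?_⟩⟩
  · intro p hp
    by_cases hpl : p ∈ l
    · by_cases hlast : p = l.getLast h
      · exact hcl' (hlast ▸ hp)
      · obtain ⟨a, b, hab, hb, hR, hpa⟩ := dropLast_succ hc hpl h hlast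
        have h1 := hf _ _ _ hR hp
        have ha : a ≠ [] := List.ne_nil_of_mem hpa
        subst hab
        rw [List.head_append_of_ne_nil ha] at h1
        exact (List.nodup_append.1 hn).2.2 _ (List.head_mem ha) _ (List.head_mem hb) h1.symm
    · have := hmax (p :: l) ⟨?_, List.nodup_cons.2 ⟨hpl, hn⟩, hin.trans (List.suffix_cons p l).isInfix⟩
      · simp at this
      · rw [List.isChain_cons]
        refine ⟨fun y hy => ?_, hc⟩
        rw [List.head?_eq_some_head h] at hy
        simp at hy
        exact hy ▸ hp
  · intro p hp
    by_cases hpl : p ∈ l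
    · by_cases hfirst : p = l.head h
      · exact hcl' (hfirst ▸ hp)
      · obtain ⟨a, b, hab, ha, hR, hpb⟩ := tail_pred hc hpl h hfirst
        have h1 := hi _ _ _ hR hp
        have hb : b ≠ [] := List.ne_nil_of_mem hpb
        subst hab
        rw [List.getLast_append_of_ne_nil _ hb] at h1
        exact (List.nodup_append.1 hn).2.2 _ (List.getLast_mem ha) _ (List.getLast_mem hb) h1
    · have := hmax (l ++ [p]) ⟨?_, ?_, hin.trans (List.prefix_append l [p]).isInfix⟩
      · simp at this
      · rw [List.isChain_append]
        refine ⟨hc, by simp, fun x hx y hy => ?_⟩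
        rw [List.getLast?_eq_some_getLast h] at hx
        simp at hx hy
        exact hx ▸ hy ▸ hp
      · rw [List.nodup_append]
        refine ⟨hn, by simp, fun x hx y hy => ?_⟩
        simp at hy
        rintro rfl
        exact hpl (hy ▸ hx)

end abstractChain

theorem cycChain_iff {α : Type} {R : α → α → Prop} {l : List α} (h : l ≠ []) :
    Cycle.Chain R (l : Cycle α) ↔ (l.IsChain R ∧ R (l.getLast h) (l.head h)) := by
  cases l with
  | nil => exact absurd rfl h
  | cons a t =>
    rw [Cycle.chain_coe_cons, ← List.cons_append, List.isChain_append]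
    simp only [List.head_cons]
    constructor
    · rintro ⟨h1, -, h3⟩
      exact ⟨h1, h3 _ (List.getLast_mem_getLast? h) _ (by simp)⟩
    · rintro ⟨h1, h2⟩
      refine ⟨h1, by simp, fun x hx y hy => ?_⟩
      rw [List.getLast?_eq_some_getLast h] at hx
      simp only [Option.mem_def, Option.some.injEq, List.head?_cons] at hx hy
      exact hx ▸ hy ▸ h2

theorem cycChain_common {α : Type} {R R' : α → α → Prop} {l : List α}
    (h : Cycle.Chain R (l : Cycle α)) (h' : Cycle.Chain R' (l : Cycle α)) {c : α} (hc : c ∈ l) :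
    ∃ e, R c e ∧ R' c e := by
  obtain ⟨a, b, rfl⟩ := List.append_of_mem hc
  have hr : ((a ++ c :: b : List α) : Cycle α) = ((c :: (b ++ a) : List α) : Cycle α) := by
    rw [Cycle.coe_eq_coe]
    exact List.isRotated_append
  rw [hr, Cycle.chain_coe_cons] at h h'
  cases hba : b ++ a with
  | nil => 
    rw [hba] at h h'
    exact ⟨c, by simpa using h, by simpa using h'⟩
  | cons e t =>
    rw [hba] at h h'
    simp only [List.cons_append, List.isChain_cons_cons] at h h'
    exact ⟨e, h.1, h'.1⟩

open TabSub

variable {A : Type} [CommRing A] {ι : Type} [Fintype ι] [DecidableEq ι] {n : ι → ℕ} {s : ℕ}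

theorem cell_ext {c d : TabCell n} (h1 : c.1 = d.1) (h2 : (c.2 : ℕ) = (d.2 : ℕ)) : c = d := by
  obtain ⟨i, x⟩ := c
  obtain ⟨j, y⟩ := d
  simp only at h1
  subst h1
  simp only at h2
  rw [Fin.ext h2]

theorem succ_fun (T : TabSub A ι n s) (q1 q2 : ι) (a b b' : TabCell n)
    (h : T.Succ q1 q2 a b) (h' : T.Succ q1 q2 a b') : b = b' := by
  obtain ⟨h1, h2, h3, h4⟩ := h
  obtain ⟨-, h2', h3', h4'⟩ := h'
  refine cell_ext ?_ (h4.symm.trans h4')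
  grind

theorem succ_tp (T : TabSub A ι n s) (q1 q2 : ι) (a b : TabCell n)
    (h : T.Succ q1 q2 a b) : T.Succ q1 q2 (T.mate b) (T.mate a) := by
  obtain ⟨h1, h2, h3, h4⟩ := h
  refine ⟨?_, h1, ?_, ?_⟩
  · rw [T.mate_invol]; exact h2
  · rw [T.mate_invol]; exact h3.symm
  · rw [T.mate_invol]; exact h4.symm

theorem succ_inj (T : TabSub A ι n s) (q1 q2 : ι) (a a' b : TabCell n)
    (h : T.Succ q1 q2 a b) (h' : T.Succ q1 q2 a' b) : a = a' :=
  T.mate.injective (succ_fun T q1 q2 _ _ _ (succ_tp T q1 q2 _ _ h) (succ_tp T q1 q2 _ _ h'))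

theorem exists_succ (T : TabSub A ι n s) {q1 q2 : ι} (hq : q1 ≠ q2) (hn : n q1 = n q2)
    (a : TabCell n) (h : (T.mate a).1 = q1 ∨ (T.mate a).1 = q2) : ∃ b, T.Succ q1 q2 a b := by
  rcases h with h | h
  · exact ⟨⟨q2, Fin.cast (by rw [h, hn]) (T.mate a).2⟩, Or.inl h, Or.inr rfl,
      by simpa [h] using hq, by simp⟩
  · exact ⟨⟨q1, Fin.cast (by rw [h, hn]) (T.mate a).2⟩, Or.inr h, Or.inl rfl,
      by simpa [h] using hq.symm, by simp⟩

theorem exists_pred (T : TabSub A ι n s) {q1 q2 : ι} (hq : q1 ≠ q2) (hn : n q1 = n q2)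
    (b : TabCell n) (h : b.1 = q1 ∨ b.1 = q2) : ∃ a, T.Succ q1 q2 a b := by
  obtain ⟨x, hx⟩ := exists_succ T hq hn (T.mate b) (by rwa [T.mate_invol])
  have := succ_tp T q1 q2 _ _ hx
  rw [T.mate_invol] at this
  exact ⟨_, this⟩

theorem path_dichotomy (T : TabSub A ι n s) {q1 q2 : ι} (hq : q1 ≠ q2) (hn : n q1 = n q2)
    {c d : TabCell n} (hcd : T.Succ q1 q2 c d) :
    (∃ l, T.IsOpenPath q1 q2 l ∧ [c, d] <:+: l) ∨ (∃ l, T.IsClosedPath q1 q2 l ∧ c ∈ l) := by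
  rcases chain_dichotomy (succ_fun T q1 q2) (succ_inj T q1 q2) hcd with
    ⟨l, h1, h2, h3, h4⟩ | ⟨l, h0, h1, h2, h3, h4⟩
  · refine Or.inl ⟨l, ⟨⟨List.ne_nil_of_mem (h3.subset (by simp : c ∈ [c, d])), h1, h2⟩,
      by simpa using h3.length_le, fun h => ⟨?_, ?_⟩⟩, h3⟩
    · rw [← not_or]
      intro h'
      obtain ⟨p, hp⟩ := exists_pred T hq hn _ h'
      exact (h4 h).1 p hp
    · rw [← not_or]
      intro h'
      obtain ⟨p, hp⟩ := exists_succ T hq hn _ h'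
      exact (h4 h).2 p hp
  · exact Or.inr ⟨l, ⟨⟨h0, h1, h2⟩, h4⟩, h3⟩

/-- The successiveness relation of `T^τ` seen on arrows of `T`. -/
def S (T : TabSub A ι n s) (q1 q2 : ι) (τ : Equiv.Perm (Fin (n q2))) (c d : TabCell n) : Prop :=
  (T.tw q2 τ).Succ q1 q2 (colPerm n q2 τ c) (colPerm n q2 τ d)

theorem tw_mate (T : TabSub A ι n s) (q : ι) (τ : Equiv.Perm (Fin (n q))) (c : TabCell n) :
    (T.tw q τ).mate c = colPerm n q τ (T.mate ((colPerm n q τ).symm c)) := rfl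

theorem S_tp (T : TabSub A ι n s) (q1 q2 : ι) (τ : Equiv.Perm (Fin (n q2))) (a b : TabCell n)
    (h : S T q1 q2 τ a b) : S T q1 q2 τ (T.mate b) (T.mate a) := by
  have := succ_tp _ _ _ _ _ h
  simpa [S, tw_mate] using this

theorem underlying_tp (T : TabSub A ι n s) (q2 : ι) (τ : Equiv.Perm (Fin (n q2)))
    (l : List (TabCell n)) :
    T.underlying q2 τ ((T.tw q2 τ).tp l) = T.tp (T.underlying q2 τ l) := by
  simp [underlying, tp, tw_mate, Function.comp_def]

theorem underlying_eqT (T : TabSub A ι n s) (q2 : ι) (τ : Equiv.Perm (Fin (n q2)))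
    {l l' : List (TabCell n)} (h : (T.tw q2 τ).eqT l l') :
    T.eqT (T.underlying q2 τ l) (T.underlying q2 τ l') := by
  rcases h with rfl | rfl
  · exact Or.inl rfl
  · exact Or.inr (underlying_tp _ _ _ _)

theorem underlying_eqCT (T : TabSub A ι n s) (q2 : ι) (τ : Equiv.Perm (Fin (n q2)))
    {l l' : List (TabCell n)} (h : (T.tw q2 τ).eqCT l l') :
    T.eqCT (T.underlying q2 τ l) (T.underlying q2 τ l') := by
  rcases h with h | h
  · exact Or.inl (h.map _)
  · refine Or.inr ?_
    rw [← underlying_tp]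
    exact h.map _

theorem chain_underlying (T : TabSub A ι n s) (q1 q2 : ι) (τ : Equiv.Perm (Fin (n q2)))
    {l : List (TabCell n)} (h : l.IsChain ((T.tw q2 τ).Succ q1 q2)) :
    (T.underlying q2 τ l).IsChain (S T q1 q2 τ) := by
  rw [underlying, List.isChain_map]
  simpa [S] using h

theorem cyc_underlying (T : TabSub A ι n s) (q1 q2 : ι) (τ : Equiv.Perm (Fin (n q2)))
    {l : List (TabCell n)} (h : (T.tw q2 τ).IsClosedPath q1 q2 l) :
    Cycle.Chain (S T q1 q2 τ) (T.underlying q2 τ l : Cycle (TabCell n)) := by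
  have h0 := h.1.1
  rw [cycChain_iff (by simpa [underlying] using h0)]
  refine ⟨chain_underlying T q1 q2 τ h.1.2.1, ?_⟩
  simpa [S, underlying] using h.2 h0

theorem chain_tp (T : TabSub A ι n s) (q1 q2 : ι) (τ : Equiv.Perm (Fin (n q2)))
    {l : List (TabCell n)} (h : l.IsChain (S T q1 q2 τ)) : (T.tp l).IsChain (S T q1 q2 τ) := by
  rw [tp, List.isChain_reverse, List.isChain_map]
  exact h.imp fun a b hab => S_tp T q1 q2 τ a b hab

theorem chain_eqT (T : TabSub A ι n s) (q1 q2 : ι) (τ : Equiv.Perm (Fin (n q2)))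
    {l l' : List (TabCell n)} (h : l'.IsChain (S T q1 q2 τ)) (hl : T.eqT l l') :
    l.IsChain (S T q1 q2 τ) := by
  rcases hl with rfl | rfl
  · exact h
  · exact chain_tp T q1 q2 τ h

theorem cyc_tp (T : TabSub A ι n s) (q1 q2 : ι) (τ : Equiv.Perm (Fin (n q2)))
    {l : List (TabCell n)} (h : Cycle.Chain (S T q1 q2 τ) (l : Cycle (TabCell n))) :
    Cycle.Chain (S T q1 q2 τ) (T.tp l : Cycle (TabCell n)) := by
  by_cases h0 : l = []
  · subst h0; exact h
  rw [cycChain_iff h0] at h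
  rw [cycChain_iff (by simpa [tp] using h0)]
  refine ⟨chain_tp T q1 q2 τ h.1, ?_⟩
  simpa [tp] using S_tp T q1 q2 τ _ _ h.2

theorem cyc_eqCT (T : TabSub A ι n s) (q1 q2 : ι) (τ : Equiv.Perm (Fin (n q2)))
    {l l' : List (TabCell n)} (h : Cycle.Chain (S T q1 q2 τ) (l' : Cycle (TabCell n)))
    (hl : T.eqCT l l') : Cycle.Chain (S T q1 q2 τ) (l : Cycle (TabCell n)) := by
  rcases hl with hl | hl
  · rw [Cycle.coe_eq_coe.2 hl]; exact h
  · rw [Cycle.coe_eq_coe.2 hl]; exact cyc_tp T q1 q2 τ h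

theorem exists_of_rel {α β : Type} {r : α → β → Prop} {u : Multiset α} {v : Multiset β}
    (h : Multiset.Rel r u v) {a : α} (ha : a ∈ u) : ∃ b ∈ v, r a b :=
  Multiset.exists_mem_of_rel_of_mem h ha

theorem S_transfer (T : TabSub A ι n s) {q1 q2 : ι} (hq : q1 ≠ q2) (hn : n q1 = n q2)
    (Ro Rcl : Equiv.Perm (Fin (n q2)) → Finset (List (TabCell n)))
    (hRo : ∀ τ, (T.tw q2 τ).OpenReps q1 q2 (Ro τ))
    (hRcl : ∀ τ, (T.tw q2 τ).ClosedReps q1 q2 (Rcl τ))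
    (π₁ π₂ : Equiv.Perm (Fin (n q2)))
    (ho : Multiset.Rel T.eqT
          ((Ro π₁).val.map (T.underlying q2 π₁)) ((Ro π₂).val.map (T.underlying q2 π₂)))
    (hc : Multiset.Rel T.eqCT
          ((Rcl π₁).val.map (T.underlying q2 π₁)) ((Rcl π₂).val.map (T.underlying q2 π₂)))
    {c d : TabCell n} (h : S T q1 q2 π₁ c d) : S T q1 q2 π₂ c d := by
  rcases path_dichotomy (T.tw q2 π₁) hq hn h with ⟨l, hl, hin⟩ | ⟨l, hl, hin⟩
  · obtain ⟨r, ⟨hr, hlr⟩, -⟩ := (hRo π₁).2 l hl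
    obtain ⟨w, hw, hrw⟩ := exists_of_rel ho (Multiset.mem_map_of_mem _ hr)
    obtain ⟨r₂, hr₂, rfl⟩ := Multiset.mem_map.1 hw
    have h2 := chain_underlying T q1 q2 π₂ ((hRo π₂).1 r₂ hr₂).1.2.1
    have h3 := chain_eqT T q1 q2 π₂ (chain_eqT T q1 q2 π₂ h2 hrw) (underlying_eqT T q2 π₁ hlr)
    have h4 := h3.infix (hin.map (colPerm n q2 π₁).symm)
    simpa using h4
  · obtain ⟨r, ⟨hr, hlr⟩, -⟩ := (hRcl π₁).2 l hl
    obtain ⟨w, hw, hrw⟩ := exists_of_rel hc (Multiset.mem_map_of_mem _ hr)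
    obtain ⟨r₂, hr₂, rfl⟩ := Multiset.mem_map.1 hw
    have h2 := cyc_underlying T q1 q2 π₂ ((hRcl π₂).1 r₂ hr₂)
    have h3 := cyc_eqCT T q1 q2 π₂ (cyc_eqCT T q1 q2 π₂ h2 hrw) (underlying_eqCT T q2 π₁ hlr)
    have h4 := cyc_underlying T q1 q2 π₁ hl
    have hcm : c ∈ T.underlying q2 π₁ l :=
      List.mem_map.2 ⟨_, hin, by simp⟩
    obtain ⟨e, he1, he2⟩ := cycChain_common h4 h3 hcm
    have : d = e := (colPerm n q2 π₁).injective (succ_fun _ _ _ _ _ _ h he1)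
    exact this ▸ he2

theorem colPerm_self (q : ι) (τ : Equiv.Perm (Fin (n q))) (k : Fin (n q)) :
    colPerm n q τ ⟨q, k⟩ = ⟨q, τ k⟩ := by
  simp [colPerm, Equiv.sigmaCongrRight]

theorem colPerm_other {p q : ι} (hpq : p ≠ q) (τ : Equiv.Perm (Fin (n q))) (k : Fin (n p)) :
    colPerm n q τ ⟨p, k⟩ = ⟨p, k⟩ := by
  simp [colPerm, Equiv.sigmaCongrRight, hpq]

theorem S_iff (T : TabSub A ι n s) {q1 q2 : ι} (hq : q1 ≠ q2) (τ : Equiv.Perm (Fin (n q2)))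
    (i : Fin (n q1)) (k : Fin (n q2)) :
    S T q1 q2 τ (T.mate ⟨q1, i⟩) ⟨q2, k⟩ ↔ (i : ℕ) = (τ k : ℕ) := by
  have h1 : (T.tw q2 τ).mate (colPerm n q2 τ (T.mate ⟨q1, i⟩)) = ⟨q1, i⟩ := by
    rw [tw_mate, Equiv.symm_apply_apply, T.mate_invol, colPerm_other hq]
  unfold S Succ
  rw [h1, colPerm_self]
  simp [hq]

end Stmt14Aux

open TabSub in
/-- A permutation `τ` is uniquely determined by the open paths of `T^τ` up to
transposition and the closed paths of `T^τ` up to cyclic permutation and transposition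
(comparing their underlying words of arrows of `T`). -/
theorem stmt14 (A : Type) [CommRing A] (m s : ℕ) (n : Fin m → ℕ)
    (T : TabSub A (Fin m) n s)
    (q1 q2 : Fin m) (hq : q1 < q2) (hn : n q1 = n q2)
    (Ro Rcl : Equiv.Perm (Fin (n q2)) → Finset (List (TabCell n)))
    (hRo : ∀ τ, (T.tw q2 τ).OpenReps q1 q2 (Ro τ))
    (hRcl : ∀ τ, (T.tw q2 τ).ClosedReps q1 q2 (Rcl τ))
    (π₁ π₂ : Equiv.Perm (Fin (n q2))) :
    π₁ = π₂ ↔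
      (Multiset.Rel T.eqT
          ((Ro π₁).val.map (T.underlying q2 π₁)) ((Ro π₂).val.map (T.underlying q2 π₂)) ∧
       Multiset.Rel T.eqCT
          ((Rcl π₁).val.map (T.underlying q2 π₁)) ((Rcl π₂).val.map (T.underlying q2 π₂))) := by
  constructor
  · rintro rfl
    exact ⟨Multiset.rel_refl_of_refl_on fun _ _ => Or.inl rfl,
      Multiset.rel_refl_of_refl_on fun _ _ => Or.inl (List.IsRotated.refl _)⟩
  · rintro ⟨ho, hc⟩
    ext k
    have h1 := (Stmt14Aux.S_iff T hq.ne π₁ (Fin.cast hn.symm (π₁ k)) k).2 rfl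
    have h2 := Stmt14Aux.S_transfer T hq.ne hn Ro Rcl hRo hRcl π₁ π₂ ho hc h1
    exact (Stmt14Aux.S_iff T hq.ne π₂ _ k).1 h2
end

section
/- Let (T,(X_1,…,X_s)) be a tableau with substitution of dimension (n_1,…,n_m) with distinguished columns q_1, q_2 and n_{q_1} = n_{q_2} = n, and let a, b ∈t T with a ≠ b and a ≠ b^t. Suppose a' = b' ∈ {q_1,q_2} and a'' = b'' ∉ {q_1,q_2}. Then for the transposition π = ('a, 'b) ∈ S_n, the open paths of T^π correspond, up to transpose, to the open paths of T with a and b interchanged, and the closed paths of T^π correspond, up to cyclic permutation and transpose, to the closed paths of T: T_o^π ∼t T_o|_{a→b, b→a} and T_cl^π ∼ct T_cl. -/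
open scoped BigOperators
set_option linter.unusedVariables false

attribute [local instance] Classical.propDecidable

namespace TabSub

variable {A : Type} [CommRing A] {ι : Type} [Fintype ι] [DecidableEq ι] {n : ι → ℕ} {s : ℕ}

/-- Transport of representatives along a bijection of classes. -/
theorem rel_reps {α : Type} (P Q : α → Prop) (E r : α → α → Prop) (F G : α → α)
    (R S : Finset α) (hF : ∀ x, P x → Q (F x)) (hG : ∀ z, Q z → P (G z))
    (hFG : ∀ z, F (G z) = z) (hE : ∀ x y, E x y ↔ r (F x) (F y))
    (hrefl : ∀ x, r x x) (hsymm : ∀ x y, r x y → r y x)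
    (htrans : ∀ x y z, r x y → r y z → r x z)
    (hR : (∀ l ∈ R, P l) ∧ ∀ l, P l → ∃! l', l' ∈ R ∧ E l l')
    (hS : (∀ l ∈ S, Q l) ∧ ∀ l, Q l → ∃! l', l' ∈ S ∧ r l l') :
    Multiset.Rel (fun x z => Q (F x) ∧ r (F x) z) R.val S.val := by
  classical
  have hex : ∀ x, ∃ z, x ∈ R → (z ∈ S ∧ r (F x) z) := by
    intro x
    by_cases hx : x ∈ R
    · obtain ⟨z, hz, -⟩ := hS.2 (F x) (hF x (hR.1 x hx))
      exact ⟨z, fun _ => hz⟩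
    · exact ⟨x, fun h => absurd h hx⟩
  choose g hg using hex
  have hinj : Set.InjOn g (R : Set α) := by
    intro x hx y hy hxy
    have hx' : x ∈ R := hx
    have hy' : y ∈ R := hy
    have h1 := (hg x hx').2
    have h2 := (hg y hy').2
    rw [← hxy] at h2
    have h3 : E x y := (hE x y).2 (htrans _ _ _ h1 (hsymm _ _ h2))
    exact (hR.2 x (hR.1 x hx')).unique ⟨hx', (hE x x).2 (hrefl _)⟩ ⟨hy', h3⟩
  have himg : R.image g = S := by
    ext z
    simp only [Finset.mem_image]
    constructor
    · rintro ⟨x, hx, rfl⟩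
      exact (hg x hx).1
    · intro hz
      obtain ⟨x, ⟨hx, hzx⟩, -⟩ := hR.2 (G z) (hG z (hS.1 z hz))
      rw [hE, hFG] at hzx
      refine ⟨x, hx, ?_⟩
      exact (hS.2 (F x) (hF x (hR.1 x hx))).unique (hg x hx) ⟨hz, hsymm _ _ hzx⟩
  have hval : S.val = R.val.map g := by
    rw [← himg]
    exact Finset.image_val_of_injOn hinj
  rw [hval, Multiset.rel_map_right]
  exact Multiset.rel_refl_of_refl_on fun x hx => ⟨hF x (hR.1 x hx), (hg x hx).2⟩

theorem tp_tp (T : TabSub A ι n s) (l : List (TabCell n)) : T.tp (T.tp l) = l := by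
  have : (T.mate ∘ T.mate : TabCell n → TabCell n) = id := funext T.mate_invol
  simp [tp, List.map_reverse, this]

theorem eqT_symm (T : TabSub A ι n s) (l l' : List (TabCell n)) (h : T.eqT l l') :
    T.eqT l' l := by
  rcases h with rfl | rfl
  · exact Or.inl rfl
  · exact Or.inr (T.tp_tp _).symm

theorem eqT_trans (T : TabSub A ι n s) (l l' l'' : List (TabCell n)) (h : T.eqT l l')
    (h' : T.eqT l' l'') : T.eqT l l'' := by
  rcases h with rfl | rfl
  · exact h'
  · rcases h' with rfl | rfl
    · exact Or.inr rfl
    · exact Or.inl (T.tp_tp _)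

theorem tp_rot (T : TabSub A ι n s) {l l' : List (TabCell n)} (h : l.IsRotated l') :
    (T.tp l).IsRotated (T.tp l') := (h.map T.mate).reverse

theorem eqCT_symm (T : TabSub A ι n s) (l l' : List (TabCell n)) (h : T.eqCT l l') :
    T.eqCT l' l := by
  rcases h with h | h
  · exact Or.inl h.symm
  · have := (T.tp_rot h).symm
    rw [tp_tp] at this
    exact Or.inr this

theorem eqCT_trans (T : TabSub A ι n s) (l l' l'' : List (TabCell n)) (h : T.eqCT l l')
    (h' : T.eqCT l' l'') : T.eqCT l l'' := by
  rcases h with h | h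
  · rcases h' with h' | h'
    · exact Or.inl (h.trans h')
    · exact Or.inr (h.trans h')
  · rcases h' with h' | h'
    · exact Or.inr (h.trans (T.tp_rot h'))
    · have := T.tp_rot h'
      rw [tp_tp] at this
      exact Or.inl (h.trans this)

section transport

variable (T T' : TabSub A ι n s) (f : TabCell n → TabCell n) (g : TabCell n → TabCell n)

theorem tp_map (hm : ∀ c, f (T'.mate c) = T.mate (f c)) (l : List (TabCell n)) :
    (T'.tp l).map f = T.tp (l.map f) := by
  simp [tp, List.map_reverse, hm]

theorem eqT_map (hf : Function.Injective f) (hm : ∀ c, f (T'.mate c) = T.mate (f c))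
    (l l' : List (TabCell n)) : T'.eqT l l' ↔ T.eqT (l.map f) (l'.map f) := by
  unfold eqT
  rw [← tp_map T T' f hm, (List.map_injective_iff.2 hf).eq_iff,
    (List.map_injective_iff.2 hf).eq_iff]

theorem rot_map {f : TabCell n → TabCell n} (hf : Function.Injective f)
    (l l' : List (TabCell n)) : (l.map f).IsRotated (l'.map f) ↔ l.IsRotated l' := by
  constructor
  · rintro ⟨k, hk⟩
    rw [← List.map_rotate] at hk
    exact ⟨k, List.map_injective_iff.2 hf hk⟩
  · exact fun h => h.map f

theorem eqCT_map (hf : Function.Injective f) (hm : ∀ c, f (T'.mate c) = T.mate (f c))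
    (l l' : List (TabCell n)) : T'.eqCT l l' ↔ T.eqCT (l.map f) (l'.map f) := by
  unfold eqCT
  rw [← tp_map T T' f hm, rot_map hf, rot_map hf]

theorem isPath_map (q1 q2 : ι) (hf : Function.Injective f)
    (hs : ∀ c d, T'.Succ q1 q2 c d ↔ T.Succ q1 q2 (f c) (f d)) (l : List (TabCell n)) :
    T'.IsPath q1 q2 l ↔ T.IsPath q1 q2 (l.map f) := by
  unfold IsPath
  have h1 : l.IsChain (T'.Succ q1 q2) ↔ (l.map f).IsChain (T.Succ q1 q2) := by
    rw [List.isChain_map]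
    have : (T'.Succ q1 q2) = fun c d => T.Succ q1 q2 (f c) (f d) := by
      ext c d; exact hs c d
    rw [this]
  have h2 : l.Nodup ↔ (l.map f).Nodup := (List.nodup_map_iff hf).symm
  have h3 : l ≠ [] ↔ l.map f ≠ [] := by simp
  exact and_congr h3 (and_congr h1 h2)

theorem isOpenPath_map (q1 q2 : ι) (hf : Function.Injective f)
    (hm : ∀ c, f (T'.mate c) = T.mate (f c)) (hc : ∀ c, (f c).1 = c.1)
    (hs : ∀ c d, T'.Succ q1 q2 c d ↔ T.Succ q1 q2 (f c) (f d)) (l : List (TabCell n)) :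
    T'.IsOpenPath q1 q2 l ↔ T.IsOpenPath q1 q2 (l.map f) := by
  unfold IsOpenPath
  rw [← isPath_map T T' f q1 q2 hf hs]
  simp [← hm, hc]

theorem isClosedPath_map (q1 q2 : ι) (hf : Function.Injective f)
    (hs : ∀ c d, T'.Succ q1 q2 c d ↔ T.Succ q1 q2 (f c) (f d)) (l : List (TabCell n)) :
    T'.IsClosedPath q1 q2 l ↔ T.IsClosedPath q1 q2 (l.map f) := by
  unfold IsClosedPath
  rw [← isPath_map T T' f q1 q2 hf hs]
  simp [hs]

end transport

/-- Every letter of a closed path has both tail and head in the columns `q1, q2`. -/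
theorem closed_mem (T : TabSub A ι n s) (q1 q2 : ι) (l : List (TabCell n))
    (h : T.IsClosedPath q1 q2 l) (c : TabCell n) (hc : c ∈ l) :
    (c.1 = q1 ∨ c.1 = q2) ∧ ((T.mate c).1 = q1 ∨ (T.mate c).1 = q2) := by
  obtain ⟨⟨hne, hch, -⟩, hcl⟩ := h
  have hcl := hcl hne
  replace hch : l.IsChain (T.Succ q1 q2) := hch
  obtain ⟨i, hi, rfl⟩ := List.getElem_of_mem hc
  rw [List.isChain_iff_getElem] at hch
  constructor
  · rcases i with _ | i
    · rw [List.head_eq_getElem] at hcl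
      exact hcl.2.1
    · exact (hch i hi).2.1
  · by_cases hi' : i + 1 < l.length
    · exact (hch i hi').1
    · rw [List.getLast_eq_getElem] at hcl
      have : i = l.length - 1 := by omega
      subst this
      exact hcl.1

section swapSubs

variable (T : TabSub A ι n s) (a b : TabCell n) (hab : a ≠ b) (habt : a ≠ T.mate b)

theorem swapSub_invol (hab : a ≠ b) (habt : a ≠ T.mate b) (c : TabCell n) :
    T.swapSub a b (T.swapSub a b c) = c := by
  have h1 := T.mate_ne a
  have h2 := T.mate_ne b
  have h3 := T.mate_invol a
  have h4 := T.mate_invol b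
  unfold swapSub
  grind

theorem swapSub_mate (hab : a ≠ b) (habt : a ≠ T.mate b) (c : TabCell n) :
    T.swapSub a b (T.mate c) = T.mate (T.swapSub a b c) := by
  have h1 := T.mate_ne a
  have h2 := T.mate_ne b
  have h3 := T.mate_invol a
  have h4 := T.mate_invol b
  have h5 := T.mate_invol c
  unfold swapSub
  grind

theorem swapSub_col (htail : a.1 = b.1) (hhead : (T.mate a).1 = (T.mate b).1)
    (c : TabCell n) : (T.swapSub a b c).1 = c.1 := by
  unfold swapSub
  grind

theorem cell_ext {c d : TabCell n} (h : c.1 = d.1) (h' : (c.2 : ℕ) = d.2) : c = d := by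
  obtain ⟨i, x⟩ := c
  obtain ⟨j, y⟩ := d
  obtain rfl : i = j := h
  obtain rfl : x = y := Fin.ext h'
  rfl

theorem swapSub_num (htail : a.1 = b.1) (hhead : (T.mate a).1 = (T.mate b).1)
    (c : TabCell n) (hca : c.1 ≠ a.1) :
    ((T.swapSub a b c).2 : ℕ) = if c.1 = (T.mate a).1 then
      Equiv.swap ((T.mate a).2 : ℕ) ((T.mate b).2 : ℕ) (c.2 : ℕ) else (c.2 : ℕ) := by
  have h1 : c ≠ a := fun h => hca (by rw [h])
  have h2 : c ≠ b := fun h => hca (by rw [h, htail])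
  unfold swapSub
  rw [if_neg h1, if_neg h2]
  by_cases h3 : c = T.mate a
  · subst h3
    rw [if_pos rfl, if_pos rfl, Equiv.swap_apply_left]
  rw [if_neg h3]
  by_cases h4 : c = T.mate b
  · subst h4
    rw [if_pos rfl, if_pos hhead.symm, Equiv.swap_apply_right]
  rw [if_neg h4]
  split_ifs with h5
  · rw [Equiv.swap_apply_of_ne_of_ne]
    · exact fun h => h3 (cell_ext h5 h)
    · exact fun h => h4 (cell_ext (h5.trans hhead) h)
  · rfl

end swapSubs

theorem colPerm_num (q : ι) (x y : Fin (n q)) (c : TabCell n) :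
    ((colPerm n q (Equiv.swap x y) c).2 : ℕ) =
      if c.1 = q then Equiv.swap (x : ℕ) (y : ℕ) (c.2 : ℕ) else (c.2 : ℕ) := by
  obtain ⟨i, z⟩ := c
  by_cases h : i = q
  · subst h
    have h0 : (colPerm n i (Equiv.swap x y) ⟨i, z⟩).2 = Equiv.swap x y z := by
      change (if h : i = i then ((finCongr (congrArg n h)).permCongr.symm (Equiv.swap x y))
        else Equiv.refl _) z = _
      rw [dif_pos rfl]
      rfl
    rw [h0]
    simp only [Equiv.swap_apply_def, Fin.ext_iff, if_true]
    split_ifs <;> rfl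
  · have h0 : (colPerm n q (Equiv.swap x y) ⟨i, z⟩).2 = z := by
      change (if h : i = q then ((finCongr (congrArg n h)).permCongr.symm (Equiv.swap x y))
        else Equiv.refl _) z = _
      rw [dif_neg h]
      rfl
    rw [h0, if_neg h]

theorem succ_aux (q1 q2 i j : ι) (x y x' y' : TabCell n) (hx : x.1 = i) (hy : y.1 = j)
    (hx' : x'.1 = i) (hy' : y'.1 = j)
    (h : (i = q1 ∨ i = q2) → (j = q1 ∨ j = q2) → i ≠ j →
      ((x.2 : ℕ) = (y.2 : ℕ) ↔ (x'.2 : ℕ) = (y'.2 : ℕ))) :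
    ((x.1 = q1 ∨ x.1 = q2) ∧ (y.1 = q1 ∨ y.1 = q2) ∧ x.1 ≠ y.1 ∧ (x.2 : ℕ) = (y.2 : ℕ)) ↔
    ((x'.1 = q1 ∨ x'.1 = q2) ∧ (y'.1 = q1 ∨ y'.1 = q2) ∧ x'.1 ≠ y'.1 ∧
      (x'.2 : ℕ) = (y'.2 : ℕ)) := by
  obtain ⟨x1, x2⟩ := x
  obtain ⟨y1, y2⟩ := y
  obtain ⟨x1', x2'⟩ := x'
  obtain ⟨y1', y2'⟩ := y'
  dsimp only at hx hy hx' hy'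
  subst hx hy hx' hy'
  exact and_congr_right fun h1 => and_congr_right fun h2 => and_congr_right fun h3 => h h1 h2 h3

theorem toQ2_val {q1 q2 : ι} (hn : n q1 = n q2) (c : TabCell n) (h : c.1 = q1 ∨ c.1 = q2) :
    (toQ2 hn c h : ℕ) = c.2 := by
  unfold toQ2
  split_ifs <;> rfl

theorem succ_tw (T : TabSub A ι n s) {q1 q2 : ι} (hq : q1 ≠ q2) (hn : n q1 = n q2)
    (a b : TabCell n) (hab : a ≠ b) (habt : a ≠ T.mate b)
    (htail : a.1 = b.1) (htailq : a.1 ≠ q1 ∧ a.1 ≠ q2)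
    (hhead : (T.mate a).1 = (T.mate b).1)
    (hheadq : (T.mate a).1 = q1 ∨ (T.mate a).1 = q2)
    (hheadqb : (T.mate b).1 = q1 ∨ (T.mate b).1 = q2)
    (π : Equiv.Perm (Fin (n q2)))
    (hπ : π = Equiv.swap (toQ2 hn (T.mate a) hheadq) (toQ2 hn (T.mate b) hheadqb))
    (c d : TabCell n) :
    (T.tw q2 π).Succ q1 q2 (colPerm n q2 π c) (colPerm n q2 π d) ↔
      T.Succ q1 q2 (T.swapSub a b c) (T.swapSub a b d) := by
  have hm : (T.tw q2 π).mate (colPerm n q2 π c) = colPerm n q2 π (T.mate c) := by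
    simp [tw, permTab]
  have hcol : ∀ x, (colPerm n q2 π x).1 = x.1 := fun _ => rfl
  unfold Succ
  rw [hm, ← swapSub_mate T a b hab habt]
  generalize T.mate c = c
  refine succ_aux q1 q2 c.1 d.1 _ _ _ _ (hcol _) (hcol _) (swapSub_col T a b htail hhead _)
    (swapSub_col T a b htail hhead _) fun h1 h2 h3 => ?_
  have h4 : c.1 ≠ a.1 := by grind
  have h5 : d.1 ≠ a.1 := by grind
  rw [swapSub_num T a b htail hhead c h4, swapSub_num T a b htail hhead d h5, hπ,
    colPerm_num, colPerm_num, toQ2_val, toQ2_val]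
  have hw : ∀ x y, Equiv.swap ((T.mate a).2 : ℕ) ((T.mate b).2 : ℕ) x = y ↔
      x = Equiv.swap ((T.mate a).2 : ℕ) ((T.mate b).2 : ℕ) y := by
    intro x y
    rw [← Equiv.eq_symm_apply, Equiv.symm_swap]
  generalize Equiv.swap ((T.mate a).2 : ℕ) ((T.mate b).2 : ℕ) = w at *
  grind

end TabSub

open TabSub in
/-- Lemma on interchanging two arrows `a, b ∈t T` with `a' = b' ∈ {q_1,q_2}` and
`a'' = b'' ∉ {q_1,q_2}`: for the transposition `π = ('a,'b)` we have
`T_o^π ∼t T_o|_{a→b,b→a}` and `T_cl^π ∼ct T_cl`. -/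
theorem stmt16 (A : Type) [CommRing A] (m s : ℕ) (n : Fin m → ℕ)
    (T : TabSub A (Fin m) n s)
    (q1 q2 : Fin m) (hq : q1 < q2) (hn : n q1 = n q2)
    (a b : TabCell n) (hab : a ≠ b) (habt : a ≠ T.mate b)
    -- `a'' = b'' ∉ {q_1,q_2}`
    (htail : a.1 = b.1) (htailq : a.1 ≠ q1 ∧ a.1 ≠ q2)
    -- `a' = b' ∈ {q_1,q_2}`
    (hhead : (T.mate a).1 = (T.mate b).1)
    (hheadq : (T.mate a).1 = q1 ∨ (T.mate a).1 = q2)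
    (hheadqb : (T.mate b).1 = q1 ∨ (T.mate b).1 = q2)
    -- `π = ('a,'b)`
    (π : Equiv.Perm (Fin (n q2)))
    (hπ : π = Equiv.swap (toQ2 hn (T.mate a) hheadq) (toQ2 hn (T.mate b) hheadqb))
    (RoT RclT Roπ Rclπ : Finset (List (TabCell n)))
    (hRoT : T.OpenReps q1 q2 RoT) (hRclT : T.ClosedReps q1 q2 RclT)
    (hRoπ : (T.tw q2 π).OpenReps q1 q2 Roπ) (hRclπ : (T.tw q2 π).ClosedReps q1 q2 Rclπ) :
    Multiset.Rel T.eqT (Roπ.val.map (T.underlying q2 π))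
      (RoT.val.map (List.map (T.swapSub a b))) ∧
    Multiset.Rel T.eqCT (Rclπ.val.map (T.underlying q2 π)) RclT.val := by
  have hcol : ∀ x, ((colPerm n q2 π).symm x).1 = x.1 := fun _ => rfl
  have hσσ := swapSub_invol T a b hab habt
  have hσm := swapSub_mate T a b hab habt
  have hσc := swapSub_col T a b htail hhead
  have hσinj : Function.Injective (T.swapSub a b) :=
    Function.LeftInverse.injective hσσ
  let f : TabCell n → TabCell n := fun c => T.swapSub a b ((colPerm n q2 π).symm c)
  let g : TabCell n → TabCell n := fun c => colPerm n q2 π (T.swapSub a b c)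
  have hfg : ∀ c, f (g c) = c := fun c => by simp [f, g, hσσ]
  have hf : Function.Injective f := hσinj.comp (Equiv.injective _)
  have hfm : ∀ c, f ((T.tw q2 π).mate c) = T.mate (f c) := fun c => by
    simp [f, tw, permTab, hσm]
  have hfc : ∀ c, (f c).1 = c.1 := fun c => by
    simp only [f]
    rw [hσc, hcol]
  have hfs : ∀ c d, (T.tw q2 π).Succ q1 q2 c d ↔ T.Succ q1 q2 (f c) (f d) := by
    intro c d
    have := succ_tw T (ne_of_lt hq) hn a b hab habt htail htailq hhead hheadq hheadqb π hπ
      ((colPerm n q2 π).symm c) ((colPerm n q2 π).symm d)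
    simpa only [Equiv.apply_symm_apply] using this
  have hFG : ∀ l : List (TabCell n), (l.map g).map f = l := fun l => by
    simp [Function.comp_def, hfg]
  have hu : ∀ l : List (TabCell n), (l.map f).map (T.swapSub a b) = T.underlying q2 π l := by
    intro l
    simp [underlying, f, hσσ]
  constructor
  · rw [Multiset.rel_map]
    refine (rel_reps (fun l => (T.tw q2 π).IsOpenPath q1 q2 l) (fun l => T.IsOpenPath q1 q2 l)
      (T.tw q2 π).eqT T.eqT (List.map f) (List.map g) Roπ RoT ?_ ?_ hFG
      (eqT_map T (T.tw q2 π) f hf hfm) (fun _ => Or.inl rfl) T.eqT_symm T.eqT_trans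
      hRoπ hRoT).mono ?_
    · exact fun l => (isOpenPath_map T (T.tw q2 π) f q1 q2 hf hfm hfc hfs l).1
    · intro l hl
      rw [isOpenPath_map T (T.tw q2 π) f q1 q2 hf hfm hfc hfs, hFG]
      exact hl
    · rintro x - z - ⟨-, h⟩
      rw [eqT_map T T (T.swapSub a b) hσinj hσm, hu] at h
      exact h
  · rw [Multiset.rel_map_left]
    refine (rel_reps (fun l => (T.tw q2 π).IsClosedPath q1 q2 l)
      (fun l => T.IsClosedPath q1 q2 l)
      (T.tw q2 π).eqCT T.eqCT (List.map f) (List.map g) Rclπ RclT ?_ ?_ hFG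
      (eqCT_map T (T.tw q2 π) f hf hfm) (fun _ => Or.inl (List.IsRotated.refl _))
      T.eqCT_symm T.eqCT_trans hRclπ hRclT).mono ?_
    · exact fun l => (isClosedPath_map T (T.tw q2 π) f q1 q2 hf hfs l).1
    · intro l hl
      rw [isClosedPath_map T (T.tw q2 π) f q1 q2 hf hfs, hFG]
      exact hl
    · rintro x - z - ⟨hcl, h⟩
      have hid : (x.map f).map (T.swapSub a b) = x.map f := by
        conv_rhs => rw [← List.map_id (x.map f)]
        refine List.map_congr_left fun c hc => ?_
        obtain ⟨h1, h2⟩ := closed_mem T q1 q2 _ hcl c hc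
        have hma := T.mate_invol a
        have hmb := T.mate_invol b
        have e1 : c ≠ a := by rintro rfl; tauto
        have e2 : c ≠ b := by rintro rfl; rw [htail] at htailq; tauto
        have e3 : c ≠ T.mate a := by rintro rfl; rw [hma] at h2; tauto
        have e4 : c ≠ T.mate b := by
          rintro rfl; rw [hmb, ← htail] at h2; tauto
        simp [swapSub, e1, e2, e3, e4]
      rw [hu] at hid
      rw [hid]
      exact h
end
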